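/- Let n ≥ 2, let β ≥ 0 and ς be real numbers, and let w be a nonzero harmonic function on the open unit ball 𝔹 ⊂ ℝⁿ satisfying n·ℰ²w + 2·ℰ³w + β((n − 2)ℰw + ℰ²w) = ς·w on 𝔹. Then there exists a (unique) nonnegative integer k such that ς = 2k³ + nk² + β(k² + (n − 2)k) = k²(n + 2k) + βk(k + n − 2), and w is the restriction to 𝔹 of a harmonic homogeneous polynomial of degree k on ℝⁿ. -/

import Mathlib

/-- The Euclidean Laplacian `Δf(x) = ∑ i, ∂²f/∂xᵢ²(x)`. -/
noncomputable def lap {n : ℕ} (f : EuclideanSpace ℝ (Fin n) → ℝ)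
    (x : EuclideanSpace ℝ (Fin n)) : ℝ :=
  ∑ i : Fin n,
    fderiv ℝ (fun y => fderiv ℝ f y (EuclideanSpace.single i 1)) x (EuclideanSpace.single i 1)

/-- The Euler operator `ℰf(x) = ∑ i, xᵢ ∂f/∂xᵢ(x) = ⟨x, ∇f(x)⟩ = df_x(x)`. -/
noncomputable def euler {n : ℕ} (f : EuclideanSpace ℝ (Fin n) → ℝ)
    (x : EuclideanSpace ℝ (Fin n)) : ℝ :=
  fderiv ℝ f x x

section RadialEquation

open Filter Asymptotics
open scoped ContDiff Topology

/-- The one-variable Euler operator `t · d/dt`. -/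
noncomputable def realEuler (g : ℝ → ℝ) (t : ℝ) : ℝ :=
  t * deriv g t

theorem ContDiff.realEuler {g : ℝ → ℝ} (hg : ContDiff ℝ ∞ g) : ContDiff ℝ ∞ (realEuler g) :=
  contDiff_id.mul ((contDiff_infty_iff_deriv.1 hg).2)

theorem ContDiff.differentiable_iteratedDeriv_of_infty {g : ℝ → ℝ} (hg : ContDiff ℝ ∞ g) (j : ℕ) :
    Differentiable ℝ (iteratedDeriv j g) :=
  hg.differentiable_iteratedDeriv j (mod_cast WithTop.coe_lt_top _)

theorem iteratedDeriv_realEuler {g : ℝ → ℝ} (hg : ContDiff ℝ ∞ g) (j : ℕ) :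
    iteratedDeriv j (realEuler g) =
      fun t => t * iteratedDeriv (j + 1) g t + j * iteratedDeriv j g t := by
  induction j with
  | zero =>
    funext t
    simp [realEuler, iteratedDeriv_one]
  | succ j ih =>
    rw [iteratedDeriv_succ, ih]
    funext t
    have h1 := (hg.differentiable_iteratedDeriv_of_infty (j + 1) t).hasDerivAt
    have h0 := (hg.differentiable_iteratedDeriv_of_infty j t).hasDerivAt
    rw [← iteratedDeriv_succ] at h1 h0
    have h := ((hasDerivAt_id t).mul h1).add (h0.const_mul (j : ℝ))
    refine h.deriv.trans ?_
    simp only [id]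
    push_cast
    ring

theorem iteratedDeriv_realEuler_zero {g : ℝ → ℝ} (hg : ContDiff ℝ ∞ g) (j : ℕ) :
    iteratedDeriv j (realEuler g) 0 = j * iteratedDeriv j g 0 := by
  simp [iteratedDeriv_realEuler hg j]

/-- A smooth function all of whose derivatives vanish at `0` is `O(tᴺ)` at `0` for every `N`. -/
theorem isBigO_pow_of_iteratedDeriv_eq_zero (N : ℕ) :
    ∀ {g : ℝ → ℝ}, ContDiff ℝ ∞ g → (∀ j, iteratedDeriv j g 0 = 0) →
      g =O[𝓝 0] fun t => t ^ N := by
  induction N with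
  | zero =>
    intro g hg _
    simpa using hg.continuous.continuousAt.isBigO_one ℝ
  | succ N ih =>
    intro g hg h0
    have hd : deriv g =O[𝓝 0] fun t => t ^ N :=
      ih (contDiff_infty_iff_deriv.1 hg).2 fun j => by
        rw [← iteratedDeriv_succ']; exact h0 (j + 1)
    obtain ⟨C, hC⟩ := hd.bound
    obtain ⟨ε, hε, hb⟩ := Metric.eventually_nhds_iff_ball.1 hC
    refine IsBigO.of_bound C ?_
    filter_upwards [Metric.ball_mem_nhds (0 : ℝ) hε] with t ht
    have hC0 : 0 ≤ C ∨ t = 0 := by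
      by_cases h : t = 0
      · exact Or.inr h
      · left
        have := (norm_nonneg _).trans (hb t ht)
        exact nonneg_of_mul_nonneg_left this (norm_pos_iff.2 (pow_ne_zero N h))
    rcases hC0 with hC0 | rfl
    · have key := (convex_closedBall (0 : ℝ) ‖t‖).norm_image_sub_le_of_norm_deriv_le
        (f := g) (C := C * ‖t‖ ^ N) (x := 0) (y := t)
        (fun s _ => (hg.differentiable (by simp)) s)
        (fun s hs => by
          have hs' : ‖s‖ ≤ ‖t‖ := by simpa using hs
          have ht' : ‖t‖ < ε := by simpa using ht
          refine (hb s (by simpa using hs'.trans_lt ht')).trans ?_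
          rw [norm_pow]
          gcongr)
        (by simp) (by simp)
      have hg0 : g 0 = 0 := by simpa using h0 0
      rw [hg0, sub_zero, sub_zero] at key
      rw [norm_pow, pow_succ]
      linarith
    · have hg0 : g 0 = 0 := by simpa using h0 0
      simp [hg0]

/-- Uniqueness for third-order Euler equations with data vanishing to infinite order at `0`. -/
theorem eq_zero_of_realEuler_equation {g : ℝ → ℝ} (hg : ContDiff ℝ ∞ g) {a b c : ℝ}
    (h0 : ∀ j, iteratedDeriv j g 0 = 0)
    (heq : ∀ t ∈ Set.Ioc (0 : ℝ) 1, realEuler (realEuler (realEuler g)) t =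
      a * g t + b * realEuler g t + c * realEuler (realEuler g) t) :
    g 1 = 0 := by
  have hg1 := hg.realEuler
  have hg2 := hg1.realEuler
  have h1 : ∀ j, iteratedDeriv j (realEuler g) 0 = 0 := fun j => by
    rw [iteratedDeriv_realEuler_zero hg, h0, mul_zero]
  have h2 : ∀ j, iteratedDeriv j (realEuler (realEuler g)) 0 = 0 := fun j => by
    rw [iteratedDeriv_realEuler_zero hg1, h1, mul_zero]
  set u := realEuler g with hu
  set v := realEuler u with hv
  obtain ⟨N, hN⟩ := exists_nat_ge (2 + 2 * (|a| + |b| + |c|))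
  set F : ℝ → ℝ := fun t => g t ^ 2 + u t ^ 2 + v t ^ 2 with hF
  have hderiv : ∀ t, HasDerivAt F
      (2 * g t * deriv g t + 2 * u t * deriv u t + 2 * v t * deriv v t) t := by
    intro t
    have hdg := ((hg.differentiable (by simp)) t).hasDerivAt
    have hdu := ((hg1.differentiable (by simp)) t).hasDerivAt
    have hdv := ((hg2.differentiable (by simp)) t).hasDerivAt
    exact (((hdg.pow 2).add (hdu.pow 2)).add (hdv.pow 2)).congr_deriv (by simp)
  have hFO : F =O[𝓝 0] fun t => t ^ (N + 1) := by
    have aux : ∀ {f : ℝ → ℝ}, ContDiff ℝ ∞ f → (∀ j, iteratedDeriv j f 0 = 0) →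
        (fun t => f t ^ 2) =O[𝓝 0] fun t => t ^ (N + 1) := by
      intro f hf hf0
      have e1 := isBigO_pow_of_iteratedDeriv_eq_zero (N + 1) hf hf0
      have e2 := isBigO_pow_of_iteratedDeriv_eq_zero 0 hf hf0
      simpa [pow_two] using e1.mul e2
    exact ((aux hg h0).add (aux hg1 h1)).add (aux hg2 h2)
  have hquot : Tendsto (fun t => F t / t ^ N) (𝓝[>] 0) (𝓝 0) := by
    have e : (fun t => F t / t ^ N) =O[𝓝[>] 0] fun t => t := by
      have := (hFO.mono nhdsWithin_le_nhds).mul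
        (isBigO_refl (fun t : ℝ => (t ^ N)⁻¹) (𝓝[>] (0 : ℝ)))
      refine (this.congr' (Eventually.of_forall fun t => (div_eq_mul_inv _ _).symm) ?_)
      filter_upwards [self_mem_nhdsWithin] with t ht
      have : t ≠ 0 := ne_of_gt ht
      field_simp
      ring
    exact e.trans_tendsto (tendsto_id.mono_left nhdsWithin_le_nhds)
  have hq : ∀ t : ℝ, t ≠ 0 → HasDerivAt (fun t => F t / t ^ N)
      (((2 * g t * deriv g t + 2 * u t * deriv u t + 2 * v t * deriv v t) * t ^ N -
        F t * (N * t ^ (N - 1))) / (t ^ N) ^ 2) t := by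
    intro t ht
    exact (hderiv t).div (hasDerivAt_pow N t) (pow_ne_zero _ ht)
  have hanti : AntitoneOn (fun t => F t / t ^ N) (Set.Ioc 0 1) := by
    refine antitoneOn_of_deriv_nonpos (convex_Ioc 0 1)
      (fun t ht => (hq t ht.1.ne').continuousAt.continuousWithinAt)
      (fun t ht => (hq t (interior_subset ht).1.ne').differentiableAt.differentiableWithinAt) ?_
    intro t ht
    have ht := interior_subset ht
    have ht0 : 0 < t := ht.1
    rw [(hq t ht0.ne').deriv]
    refine div_nonpos_of_nonpos_of_nonneg ?_ (by positivity)
    have e1 : t * deriv g t = u t := rfl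
    have e2 : t * deriv u t = v t := rfl
    have e3 : t * deriv v t = a * g t + b * u t + c * v t := heq t ht
    have hmain : 2 * g t * u t + 2 * u t * v t + 2 * v t * (a * g t + b * u t + c * v t) ≤
        N * F t := by
      have hF0 : 0 ≤ F t := by positivity
      have p1 : 2 * (v t * g t) * a ≤ F t * |a| := by
        have : |2 * (v t * g t)| ≤ F t := by
          rw [abs_le]
          constructor <;>
            nlinarith [sq_nonneg (v t + g t), sq_nonneg (v t - g t), sq_nonneg (u t)]
        calc _ ≤ |2 * (v t * g t) * a| := le_abs_self _
          _ = |2 * (v t * g t)| * |a| := abs_mul _ _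
          _ ≤ _ := by gcongr
      have p2 : 2 * (v t * u t) * b ≤ F t * |b| := by
        have : |2 * (v t * u t)| ≤ F t := by
          rw [abs_le]
          constructor <;>
            nlinarith [sq_nonneg (v t + u t), sq_nonneg (v t - u t), sq_nonneg (g t)]
        calc _ ≤ |2 * (v t * u t) * b| := le_abs_self _
          _ = |2 * (v t * u t)| * |b| := abs_mul _ _
          _ ≤ _ := by gcongr
      have p3 : v t ^ 2 * c ≤ F t * |c| := by
        have : v t ^ 2 ≤ F t := by nlinarith [sq_nonneg (g t), sq_nonneg (u t)]
        calc _ ≤ v t ^ 2 * |c| := by gcongr; exact le_abs_self c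
          _ ≤ _ := by gcongr
      have p4 : 2 * g t * u t + 2 * u t * v t ≤ 2 * F t := by
        nlinarith [sq_nonneg (g t - u t), sq_nonneg (u t - v t), sq_nonneg (g t), sq_nonneg (v t)]
      have p5 : (2 + 2 * (|a| + |b| + |c|)) * F t ≤ N * F t := by gcongr
      nlinarith [mul_nonneg hF0 (abs_nonneg a), mul_nonneg hF0 (abs_nonneg b)]
    have hmul : t * ((2 * g t * deriv g t + 2 * u t * deriv u t + 2 * v t * deriv v t) * t ^ N -
        F t * (N * t ^ (N - 1))) =
        t ^ N * (2 * g t * u t + 2 * u t * v t + 2 * v t * (a * g t + b * u t + c * v t) -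
          N * F t) := by
      have e4 : (N : ℝ) * (t * t ^ (N - 1)) = N * t ^ N := by
        rcases Nat.eq_zero_or_pos N with h | h
        · simp [h]
        · rw [mul_pow_sub_one h.ne']
      rw [← e3, ← e1, ← e2]
      linear_combination -F t * e4
    refine nonpos_of_mul_nonpos_right (a := t) ?_ ht0
    rw [hmul]
    exact mul_nonpos_of_nonneg_of_nonpos (by positivity) (by linarith)
  have hle : F 1 / 1 ^ N ≤ 0 := by
    refine ge_of_tendsto hquot ?_
    filter_upwards [Ioc_mem_nhdsGT (zero_lt_one' ℝ)] with t ht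
    exact hanti ht (by simp) ht.2
  rw [one_pow, div_one] at hle
  have : g 1 ^ 2 ≤ 0 := by
    simp only [hF] at hle
    nlinarith [sq_nonneg (u 1), sq_nonneg (v 1)]
  exact pow_eq_zero_iff (two_ne_zero) |>.1 (le_antisymm this (sq_nonneg _))

end RadialEquation

section Regularity

open Filter MeasureTheory
open scoped ContDiff Topology

variable {n : ℕ}

theorem EuclideanSpace.sum_smul_single_one (x : EuclideanSpace ℝ (Fin n)) :
    ∑ i, x i • EuclideanSpace.single i (1 : ℝ) = x := by
  simpa using (EuclideanSpace.basisFun (Fin n) ℝ).sum_repr x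

theorem lap_congr_of_eventuallyEq {f g : EuclideanSpace ℝ (Fin n) → ℝ}
    {x : EuclideanSpace ℝ (Fin n)} (h : f =ᶠ[𝓝 x] g) : lap f x = lap g x := by
  refine Finset.sum_congr rfl fun i _ => ?_
  have : (fun z => fderiv ℝ f z (EuclideanSpace.single i 1)) =ᶠ[𝓝 x]
      fun z => fderiv ℝ g z (EuclideanSpace.single i 1) :=
    (h.fderiv (𝕜 := ℝ)).mono fun z hz => by simp only [hz]
  rw [this.fderiv_eq]

/-- A radial smooth weight `φ` supported in a small ball such that `y ↦ φ y • y` is the gradient of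
a function supported in the same ball. -/
theorem exists_radial_weight (hn : 0 < n) {δ : ℝ} (hδ : 0 < δ) :
    ∃ φ Ψ : EuclideanSpace ℝ (Fin n) → ℝ, ContDiff ℝ ∞ φ ∧ ContDiff ℝ ∞ Ψ ∧
      HasCompactSupport φ ∧ HasCompactSupport Ψ ∧ (∀ y, φ (-y) = φ y) ∧
      (∀ y, Ψ y ≠ 0 → ‖y‖ < δ) ∧ (∫ y, φ y) ≠ 0 ∧
      ∀ y v, fderiv ℝ Ψ y v = φ y * inner ℝ y v := by
  set F : ℝ → ℝ := fun s => Real.smoothTransition (1 - s / δ ^ 2) with hF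
  have hFs : ContDiff ℝ ∞ F :=
    Real.smoothTransition.contDiff.comp (contDiff_const.sub (contDiff_id.div_const _))
  have hF's : ContDiff ℝ ∞ (deriv F) := (contDiff_infty_iff_deriv.1 hFs).2
  have hFanti : Antitone F := fun s t hst => Real.smoothTransition.monotone (by gcongr)
  have hFzero : ∀ s, δ ^ 2 ≤ s → F s = 0 := fun s hs =>
    Real.smoothTransition.zero_of_nonpos (by
      have : 1 ≤ s / δ ^ 2 := by rw [le_div_iff₀ (by positivity)]; linarith
      linarith)
  have hnorm : ContDiff ℝ ∞ fun y : EuclideanSpace ℝ (Fin n) => ‖y‖ ^ 2 := contDiff_norm_sq ℝ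
  have hΨsupp : ∀ y : EuclideanSpace ℝ (Fin n), F (‖y‖ ^ 2) ≠ 0 → ‖y‖ < δ := by
    intro y hy
    by_contra! h
    exact hy (hFzero _ (by gcongr))
  have hΨc : HasCompactSupport fun y : EuclideanSpace ℝ (Fin n) => F (‖y‖ ^ 2) := by
    refine HasCompactSupport.of_support_subset_isCompact (isCompact_closedBall 0 δ) fun y hy => ?_
    simpa using (hΨsupp y hy).le
  have hφc : HasCompactSupport fun y : EuclideanSpace ℝ (Fin n) => 2 * deriv F (‖y‖ ^ 2) := by
    refine HasCompactSupport.of_support_subset_isCompact (isCompact_closedBall 0 δ) fun y hy => ?_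
    by_contra h
    have h : δ < ‖y‖ := by simpa using h
    refine hy ?_
    have : F =ᶠ[𝓝 (‖y‖ ^ 2)] fun _ => (0 : ℝ) := by
      filter_upwards [Ioi_mem_nhds (show δ ^ 2 < ‖y‖ ^ 2 by gcongr)] with s hs
      exact hFzero s (le_of_lt hs)
    simp [this.deriv_eq]
  have hφs : ContDiff ℝ ∞ fun y : EuclideanSpace ℝ (Fin n) => 2 * deriv F (‖y‖ ^ 2) :=
    contDiff_const.mul (hF's.comp hnorm)
  refine ⟨fun y => 2 * deriv F (‖y‖ ^ 2), fun y => F (‖y‖ ^ 2), hφs, hFs.comp hnorm, hφc, hΨc,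
    fun y => by simp, hΨsupp, ?_, ?_⟩
  · obtain ⟨s, hs, hslope⟩ := exists_deriv_eq_slope F (a := 0) (b := δ ^ 2) (by positivity)
      hFs.continuous.continuousOn (hFs.differentiable (by simp)).differentiableOn
    have hne : deriv F s ≠ 0 := by
      rw [hslope, hFzero _ le_rfl]
      have : F 0 = 1 := by simp [hF]
      rw [this]
      have : (0 : ℝ) < δ ^ 2 := by positivity
      exact div_ne_zero (by norm_num) (by linarith)
    have hpos := Continuous.integral_pos_of_hasCompactSupport_nonneg_nonzero
      (μ := (volume : Measure (EuclideanSpace ℝ (Fin n))))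
      (f := fun y => -(2 * deriv F (‖y‖ ^ 2)))
      (x := EuclideanSpace.single ⟨0, hn⟩ (√s)) hφs.continuous.neg hφc.neg
      (fun y => by
        have := hFanti.deriv_nonpos (x := ‖y‖ ^ 2)
        simp only [Pi.zero_apply]
        linarith)
      (by simpa [Real.sq_sqrt hs.1.le] using hne)
    rw [integral_neg] at hpos
    linarith
  · intro y v
    have h1 : HasFDerivAt (fun y : EuclideanSpace ℝ (Fin n) => ‖y‖ ^ 2) _ y :=
      (hasStrictFDerivAt_norm_sq y).hasFDerivAt
    have h2 : HasDerivAt F (deriv F (‖y‖ ^ 2)) (‖y‖ ^ 2) :=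
      ((hFs.differentiable (by simp)) _).hasDerivAt
    have h3 := h2.comp_hasFDerivAt y h1
    rw [show (fun y : EuclideanSpace ℝ (Fin n) => F (‖y‖ ^ 2)) = F ∘ fun y => ‖y‖ ^ 2 from rfl,
      h3.fderiv]
    simp
    ring

/-- Weighted mean value property for harmonic functions. -/
theorem integral_mul_radial_weight_eq {W φ Ψ : EuclideanSpace ℝ (Fin n) → ℝ}
    (hW : ContDiff ℝ 2 W) (hWc : HasCompactSupport W) (hφ : Continuous φ)
    (hφc : HasCompactSupport φ) (hΨ : ContDiff ℝ 1 Ψ) (hΨc : HasCompactSupport Ψ)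
    (hgrad : ∀ y v, fderiv ℝ Ψ y v = φ y * inner ℝ y v) (x : EuclideanSpace ℝ (Fin n))
    (hlap : ∀ r ∈ Set.Icc (0 : ℝ) 1, ∀ y, Ψ y ≠ 0 → lap W (x + r • y) = 0) :
    ∫ y, W (x + y) * φ y = W x * ∫ y, φ y := by
  have hW1 : ContDiff ℝ 1 (fderiv ℝ W) := hW.fderiv_right (by norm_num)
  obtain ⟨M, hM⟩ := (hWc.fderiv (𝕜 := ℝ)).exists_bound_of_continuous hW1.continuous
  have hderiv : ∀ r : ℝ, HasDerivAt (fun r : ℝ => ∫ y, W (x + r • y) * φ y)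
      (∫ y, fderiv ℝ W (x + r • y) y * φ y) r := by
    intro r
    refine (hasDerivAt_integral_of_dominated_loc_of_deriv_le (𝕜 := ℝ) (s := Set.univ)
      (F := fun r y => W (x + r • y) * φ y)
      (F' := fun r y => fderiv ℝ W (x + r • y) y * φ y)
      (bound := fun y => M * ‖y‖ * ‖φ y‖) univ_mem
      (Eventually.of_forall fun s => ?_) ?_ ?_ ?_ ?_ ?_).2
    · exact ((hW.continuous.comp (by fun_prop)).mul hφ).aestronglyMeasurable
    · exact ((hW.continuous.comp (by fun_prop)).mul hφ).integrable_of_hasCompactSupport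
        hφc.mul_left
    · exact (((hW1.continuous.comp
        (by fun_prop : Continuous fun y : EuclideanSpace ℝ (Fin n) => x + r • y)).clm_apply
        continuous_id).mul hφ).aestronglyMeasurable
    · refine Eventually.of_forall fun y s _ => ?_
      rw [norm_mul]
      gcongr
      exact (ContinuousLinearMap.le_opNorm _ _).trans (by gcongr; exact hM _)
    · exact ((continuous_const.mul continuous_norm).mul hφ.norm).integrable_of_hasCompactSupport
        hφc.norm.mul_left
    · refine Eventually.of_forall fun y s _ => ?_
      have h1 : HasDerivAt (fun s : ℝ => x + s • y) y s := by
        simpa using ((hasDerivAt_id s).smul_const y).const_add x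
      have h2 := ((hW.differentiable (by simp)) (x + s • y)).hasFDerivAt
      exact (h2.comp_hasDerivAt s h1).mul_const (φ y)
  have hzero : ∀ r ∈ Set.Icc (0 : ℝ) 1, ∫ y, fderiv ℝ W (x + r • y) y * φ y = 0 := by
    intro r hr
    let e : Fin n → EuclideanSpace ℝ (Fin n) := fun i => EuclideanSpace.single i 1
    let f : Fin n → EuclideanSpace ℝ (Fin n) → ℝ := fun i y => fderiv ℝ W (x + r • y) (e i)
    have hDi : ∀ i, ContDiff ℝ 1 fun z => fderiv ℝ W z (e i) := fun i =>
      hW1.clm_apply contDiff_const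
    have hf : ∀ i, ContDiff ℝ 1 (f i) := fun i =>
      (hDi i).comp (contDiff_const.add (contDiff_id.const_smul r))
    have hfd : ∀ i y, fderiv ℝ (f i) y (e i) =
        r * fderiv ℝ (fun z => fderiv ℝ W z (e i)) (x + r • y) (e i) := by
      intro i y
      have h1 : HasFDerivAt (fun y : EuclideanSpace ℝ (Fin n) => x + r • y)
          (r • ContinuousLinearMap.id ℝ (EuclideanSpace ℝ (Fin n))) y :=
        ((hasFDerivAt_id y).const_smul r).const_add x
      have h2 := (((hDi i).differentiable (by simp)) (x + r • y)).hasFDerivAt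
      have h3 := h2.comp y h1
      rw [show f i = (fun z => fderiv ℝ W z (e i)) ∘ fun y => x + r • y from rfl, h3.fderiv]
      simp
    have hexp : ∀ y, fderiv ℝ W (x + r • y) y * φ y = ∑ i, f i y * fderiv ℝ Ψ y (e i) := by
      intro y
      conv_lhs => rw [← EuclideanSpace.sum_smul_single_one y, map_sum, Finset.sum_mul]
      simp only [EuclideanSpace.sum_smul_single_one]
      refine Finset.sum_congr rfl fun i _ => ?_
      rw [hgrad]
      simp [f, e, EuclideanSpace.inner_single_right]
      ring
    have hΨd : ∀ i, Continuous fun y => fderiv ℝ Ψ y (e i) := fun i =>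
      (hΨ.continuous_fderiv (by simp)).clm_apply continuous_const
    have hfdc : ∀ i, Continuous fun y => fderiv ℝ (f i) y (e i) := fun i =>
      ((hf i).continuous_fderiv (by simp)).clm_apply continuous_const
    have hint1 : ∀ i, Integrable fun y => f i y * fderiv ℝ Ψ y (e i) := fun i =>
      ((hf i).continuous.mul (hΨd i)).integrable_of_hasCompactSupport
        (hΨc.fderiv_apply (𝕜 := ℝ) (e i)).mul_left
    have hint2 : ∀ i, Integrable fun y => fderiv ℝ (f i) y (e i) * Ψ y := fun i =>
      ((hfdc i).mul hΨ.continuous).integrable_of_hasCompactSupport hΨc.mul_left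
    have hint3 : ∀ i, Integrable fun y => f i y * Ψ y := fun i =>
      ((hf i).continuous.mul hΨ.continuous).integrable_of_hasCompactSupport hΨc.mul_left
    simp_rw [hexp]
    rw [integral_finsetSum _ fun i _ => hint1 i]
    have hparts : ∀ i, ∫ y, f i y * fderiv ℝ Ψ y (e i) = -∫ y, fderiv ℝ (f i) y (e i) * Ψ y :=
      fun i => integral_mul_fderiv_eq_neg_fderiv_mul_of_integrable (hint2 i) (hint1 i) (hint3 i)
        (fun y _ => ((hf i).differentiable (by simp)) y)
        (fun y _ => (hΨ.differentiable (by simp)) y)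
    simp_rw [hparts]
    rw [Finset.sum_neg_distrib, ← integral_finsetSum _ fun i _ => hint2 i, neg_eq_zero]
    refine integral_eq_zero_of_ae (Eventually.of_forall fun y => ?_)
    simp only [hfd, Pi.zero_apply]
    rw [← Finset.sum_mul, ← Finset.mul_sum]
    by_cases hy : Ψ y = 0
    · rw [hy, mul_zero]
    · have := hlap r hr y hy
      rw [lap] at this
      simp only [e]
      rw [this, mul_zero, zero_mul]
  have hconst := constant_of_has_deriv_right_zero (a := (0 : ℝ)) (b := 1)
    (f := fun r : ℝ => ∫ y, W (x + r • y) * φ y)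
    (fun r _ => (hderiv r).continuousAt.continuousWithinAt)
    (fun r hr => by
      have := hderiv r
      rw [hzero r ⟨hr.1, hr.2.le⟩] at this
      exact this.hasDerivWithinAt) 1 (by simp)
  simpa [integral_const_mul] using hconst

/-- A harmonic function on the unit ball agrees on each smaller ball with a smooth function defined
on the whole space. -/
theorem exists_contDiff_eqOn_ball_of_lap_eq_zero (hn : 0 < n) {w : EuclideanSpace ℝ (Fin n) → ℝ}
    (hw : ContDiffOn ℝ 2 w (Metric.ball 0 1)) (hharm : ∀ x ∈ Metric.ball 0 1, lap w x = 0)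
    {ρ : ℝ} (hρ0 : 0 < ρ) (hρ : ρ < 1) :
    ∃ U : EuclideanSpace ℝ (Fin n) → ℝ, ContDiff ℝ ∞ U ∧ Set.EqOn w U (Metric.ball 0 ρ) := by
  let χ : ContDiffBump (0 : EuclideanSpace ℝ (Fin n)) :=
    ⟨(ρ + 1) / 2, (ρ + 3) / 4, by linarith, by linarith⟩
  set W : EuclideanSpace ℝ (Fin n) → ℝ := fun y => χ y * w y with hWdef
  have hχ1 : (tsupport χ : Set (EuclideanSpace ℝ (Fin n))) ⊆ Metric.ball 0 1 := by
    rw [χ.tsupport_eq]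
    exact Metric.closedBall_subset_ball (by show (ρ + 3) / 4 < 1; linarith)
  have hWc : HasCompactSupport W := χ.hasCompactSupport.mul_right
  have hW : ContDiff ℝ 2 W := by
    refine contDiff_iff_contDiffAt.2 fun y => ?_
    by_cases hy : y ∈ Metric.ball (0 : EuclideanSpace ℝ (Fin n)) 1
    · exact χ.contDiffAt.mul (hw.contDiffAt (Metric.isOpen_ball.mem_nhds hy))
    · have : W =ᶠ[𝓝 y] fun _ => 0 := by
        have hy' : y ∉ tsupport χ := fun h => hy (hχ1 h)
        filter_upwards [notMem_tsupport_iff_eventuallyEq.1 hy'] with z hz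
        simp [hWdef, hz]
      exact contDiffAt_const.congr_of_eventuallyEq this
  have hWw : Set.EqOn W w (Metric.ball 0 ((ρ + 1) / 2)) := fun y hy => by
    simp [hWdef, χ.one_of_mem_closedBall (Metric.ball_subset_closedBall hy)]
  have hWlap : ∀ y ∈ Metric.ball 0 ((ρ + 1) / 2), lap W y = 0 := by
    intro y hy
    have hev : W =ᶠ[𝓝 y] w := hWw.eventuallyEq_of_mem (Metric.isOpen_ball.mem_nhds hy)
    rw [lap_congr_of_eventuallyEq hev]
    exact hharm y (Metric.ball_subset_ball (by linarith) hy)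
  obtain ⟨φ, Ψ, hφ, hΨ, hφc, hΨc, hφe, hΨs, hφi, hgrad⟩ :=
    exists_radial_weight hn (δ := (1 - ρ) / 2) (by linarith)
  refine ⟨fun x => (∫ y, φ y)⁻¹ * convolution W φ (ContinuousLinearMap.mul ℝ ℝ) volume x,
    contDiff_const.mul (hφc.contDiff_convolution_right _ hW.continuous.locallyIntegrable hφ),
    fun x hx => ?_⟩
  have hx' : ‖x‖ < ρ := by simpa using hx
  have hmv := integral_mul_radial_weight_eq hW hWc hφ.continuous hφc (hΨ.of_le (by simp)) hΨc hgrad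
    x (fun r hr y hy => hWlap _ (by
      have h1 := hΨs y hy
      have h2 : ‖r • y‖ ≤ ‖y‖ := by
        rw [norm_smul, Real.norm_of_nonneg hr.1]
        exact mul_le_of_le_one_left (norm_nonneg _) hr.2
      have h3 := norm_add_le x (r • y)
      rw [mem_ball_zero_iff]
      linarith))
  have hconv : convolution W φ (ContinuousLinearMap.mul ℝ ℝ) volume x = ∫ y, W (x + y) * φ y := by
    rw [convolution_def, ← integral_add_left_eq_self _ x]
    simp [hφe]
  simp only [hconv]
  rw [hmv, hWw (Metric.ball_subset_ball (by linarith) hx)]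
  field_simp

end Regularity

section EulerOperator

open Filter
open scoped ContDiff Topology

/-- The eigenvalue on homogeneous functions of degree `k`. -/
noncomputable def eulerSymbol (n β k : ℝ) : ℝ :=
  2 * k ^ 3 + n * k ^ 2 + β * (k ^ 2 + (n - 2) * k)

theorem eulerSymbol_strictMono {n : ℕ} (hn : 2 ≤ n) {β : ℝ} (hβ : 0 ≤ β) :
    StrictMono fun k : ℕ => eulerSymbol n β k := by
  intro j k hjk
  have hn' : (0 : ℝ) ≤ (n : ℝ) - 2 := by
    have : (2 : ℝ) ≤ n := by exact_mod_cast hn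
    linarith
  have hjk' : (j : ℝ) < k := by exact_mod_cast hjk
  have h1 : 2 * (j : ℝ) ^ 3 < 2 * (k : ℝ) ^ 3 := by gcongr
  have h2 : (n : ℝ) * (j : ℝ) ^ 2 ≤ n * (k : ℝ) ^ 2 := by gcongr
  have h3 : β * ((j : ℝ) ^ 2 + ((n : ℝ) - 2) * j) ≤ β * ((k : ℝ) ^ 2 + ((n : ℝ) - 2) * k) := by
    gcongr
  simp only [eulerSymbol]
  linarith

theorem eulerSymbol_mul_iteratedDeriv_zero {n β ς : ℝ} {g : ℝ → ℝ} (hg : ContDiff ℝ ∞ g)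
    (heq : ∀ᶠ t in 𝓝 0, n * realEuler (realEuler g) t +
      2 * realEuler (realEuler (realEuler g)) t +
        β * ((n - 2) * realEuler g t + realEuler (realEuler g) t) = ς * g t) (j : ℕ) :
    eulerSymbol n β j * iteratedDeriv j g 0 = ς * iteratedDeriv j g 0 := by
  have hg1 := hg.realEuler
  have hg2 := hg1.realEuler
  have hg3 := hg2.realEuler
  have at0 : ∀ {f : ℝ → ℝ}, ContDiff ℝ ∞ f → ContDiffAt ℝ j f 0 := fun hf =>
    (hf.of_le (mod_cast le_top)).contDiffAt
  have h := EventuallyEq.iteratedDeriv_eq j heq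
  rw [iteratedDeriv_const_mul _ (at0 hg),
    iteratedDeriv_fun_add (at0 ((contDiff_const.mul hg2).add (contDiff_const.mul hg3)))
      (at0 (contDiff_const.mul ((contDiff_const.mul hg1).add hg2))),
    iteratedDeriv_fun_add (at0 (contDiff_const.mul hg2)) (at0 (contDiff_const.mul hg3)),
    iteratedDeriv_const_mul _ (at0 hg2), iteratedDeriv_const_mul _ (at0 hg3),
    iteratedDeriv_const_mul _ (at0 ((contDiff_const.mul hg1).add hg2)),
    iteratedDeriv_fun_add (at0 (contDiff_const.mul hg1)) (at0 hg2),
    iteratedDeriv_const_mul _ (at0 hg1), iteratedDeriv_realEuler_zero hg2,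
    iteratedDeriv_realEuler_zero hg1, iteratedDeriv_realEuler_zero hg] at h
  rw [← h, eulerSymbol]
  ring

theorem eq_zero_of_resonant_iteratedDeriv_eq_zero {n β ς : ℝ} {g : ℝ → ℝ} (hg : ContDiff ℝ ∞ g)
    (heq : ∀ t : ℝ, |t| ≤ 1 → n * realEuler (realEuler g) t +
      2 * realEuler (realEuler (realEuler g)) t +
        β * ((n - 2) * realEuler g t + realEuler (realEuler g) t) = ς * g t)
    (h0 : ∀ j : ℕ, eulerSymbol n β j = ς → iteratedDeriv j g 0 = 0) : g 1 = 0 := by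
  refine eq_zero_of_realEuler_equation hg (a := ς / 2) (b := -(β * (n - 2)) / 2)
    (c := -(n + β) / 2) (fun j => ?_) fun t ht => ?_
  · by_cases hj : eulerSymbol n β j = ς
    · exact h0 j hj
    · have hev : ∀ᶠ t : ℝ in 𝓝 0, |t| ≤ 1 := by
        filter_upwards [Metric.ball_mem_nhds (0 : ℝ) one_pos] with t ht
        simpa using (mem_ball_zero_iff.1 ht).le
      have := eulerSymbol_mul_iteratedDeriv_zero hg (hev.mono heq) j
      exact (mul_eq_mul_right_iff.1 this).resolve_left hj
  · have := heq t (abs_le.2 ⟨by linarith [ht.1], ht.2⟩)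
    linarith

theorem realEuler_sub_const_mul_pow {g : ℝ → ℝ} (hg : Differentiable ℝ g) (c : ℝ) (k : ℕ) :
    realEuler (fun t => g t - c * t ^ k) = fun t => realEuler g t - c * k * t ^ k := by
  funext t
  have h := (hg t).hasDerivAt.sub ((hasDerivAt_pow k t).const_mul c)
  rw [realEuler, realEuler]
  refine (congrArg (t * ·) h.deriv).trans ?_
  have e : (k : ℝ) * (t * t ^ (k - 1)) = k * t ^ k := by
    rcases Nat.eq_zero_or_pos k with h | h
    · simp [h]
    · rw [mul_pow_sub_one h.ne']
  linear_combination (-c) * e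

theorem eq_iteratedDeriv_div_factorial_of_resonant {n β ς : ℝ} {g : ℝ → ℝ} (hg : ContDiff ℝ ∞ g)
    (heq : ∀ t : ℝ, |t| ≤ 1 → n * realEuler (realEuler g) t +
      2 * realEuler (realEuler (realEuler g)) t +
        β * ((n - 2) * realEuler g t + realEuler (realEuler g) t) = ς * g t)
    {k : ℕ} (hk : eulerSymbol n β k = ς) (huniq : ∀ j : ℕ, eulerSymbol n β j = ς → j = k) :
    g 1 = (k.factorial : ℝ)⁻¹ * iteratedDeriv k g 0 := by
  set c := (k.factorial : ℝ)⁻¹ * iteratedDeriv k g 0 with hc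
  have hd : ∀ {f : ℝ → ℝ}, ContDiff ℝ ∞ f → Differentiable ℝ f := fun hf =>
    hf.differentiable (by simp)
  have hpow : ContDiff ℝ ∞ fun t : ℝ => c * t ^ k := contDiff_const.mul (contDiff_id.pow k)
  have key := eq_zero_of_resonant_iteratedDeriv_eq_zero (n := n) (β := β) (ς := ς)
    (g := fun t => g t - c * t ^ k) (hg.sub hpow)
    (fun t ht => by
      rw [realEuler_sub_const_mul_pow (hd hg), realEuler_sub_const_mul_pow (hd hg.realEuler),
        realEuler_sub_const_mul_pow (hd hg.realEuler.realEuler)]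
      have := heq t ht
      rw [← hk, eulerSymbol] at this ⊢
      linear_combination this)
    (fun j hj => by
      obtain rfl := huniq j hj
      have hle : ((j : ℕ) : WithTop ℕ∞) ≤ ∞ := mod_cast le_top
      rw [iteratedDeriv_fun_sub (hg.of_le hle).contDiffAt (hpow.of_le hle).contDiffAt,
        iteratedDeriv_const_mul _ (contDiff_id.pow j).contDiffAt, iteratedDeriv_pow, hc]
      have : (j.factorial : ℝ) ≠ 0 := by exact_mod_cast j.factorial_ne_zero
      simp [Nat.descFactorial_self]
      field_simp
      simp)
  simpa [sub_eq_zero] using key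

variable {n : ℕ}

theorem Set.EqOn.euler {f g : EuclideanSpace ℝ (Fin n) → ℝ} {s : Set (EuclideanSpace ℝ (Fin n))}
    (h : Set.EqOn f g s) (hs : IsOpen s) : Set.EqOn (euler f) (euler g) s := fun x hx => by
  rw [_root_.euler, _root_.euler, (h.eventuallyEq_of_mem (hs.mem_nhds hx)).fderiv_eq]

theorem ContDiff.euler {U : EuclideanSpace ℝ (Fin n) → ℝ} (hU : ContDiff ℝ ∞ U) :
    ContDiff ℝ ∞ (euler U) :=
  (hU.fderiv_right (m := ∞) (by simp)).clm_apply contDiff_id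

theorem realEuler_comp_smul {U : EuclideanSpace ℝ (Fin n) → ℝ} (hU : ContDiff ℝ ∞ U)
    (x : EuclideanSpace ℝ (Fin n)) :
    realEuler (fun t => U (t • x)) = fun t => euler U (t • x) := by
  funext t
  have h1 : HasDerivAt (fun t : ℝ => t • x) x t := by
    simpa using (hasDerivAt_id t).smul_const x
  have h2 := ((hU.differentiable (by simp)) (t • x)).hasFDerivAt.comp_hasDerivAt t h1
  rw [realEuler, euler]
  refine (congrArg (t * ·) h2.deriv).trans ?_
  simp

theorem iteratedDeriv_comp_smul_zero {U : EuclideanSpace ℝ (Fin n) → ℝ} (hU : ContDiff ℝ ∞ U)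
    (x : EuclideanSpace ℝ (Fin n)) (j : ℕ) :
    iteratedDeriv j (fun t : ℝ => U (t • x)) 0 = iteratedFDeriv ℝ j U 0 fun _ => x := by
  have := ((ContinuousLinearMap.id ℝ ℝ).smulRight x).iteratedFDeriv_comp_right hU 0
    (i := j) (mod_cast le_top)
  rw [iteratedDeriv_eq_iteratedFDeriv]
  have hcomp : (fun t : ℝ => U (t • x)) = U ∘ ((ContinuousLinearMap.id ℝ ℝ).smulRight x) := rfl
  rw [hcomp, this]
  simp

/-- Restriction to a ray of a harmonic solution of the Euler equation. -/
theorem exists_ray_restriction (hn : 0 < n) {β ς : ℝ} {w : EuclideanSpace ℝ (Fin n) → ℝ}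
    (hw : ContDiffOn ℝ 2 w (Metric.ball 0 1)) (hharm : ∀ x ∈ Metric.ball 0 1, lap w x = 0)
    (heq : ∀ x ∈ Metric.ball (0 : EuclideanSpace ℝ (Fin n)) 1,
      (n : ℝ) * euler (euler w) x + 2 * euler (euler (euler w)) x +
        β * (((n : ℝ) - 2) * euler w x + euler (euler w) x) = ς * w x)
    {x : EuclideanSpace ℝ (Fin n)} (hx : x ∈ Metric.ball 0 1) :
    ∃ g : ℝ → ℝ, ContDiff ℝ ∞ g ∧ g 1 = w x ∧
      (∀ j, iteratedDeriv j g 0 = iteratedFDeriv ℝ j w 0 fun _ => x) ∧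
      ∀ t : ℝ, |t| ≤ 1 → n * realEuler (realEuler g) t +
        2 * realEuler (realEuler (realEuler g)) t +
          β * ((n - 2) * realEuler g t + realEuler (realEuler g) t) = ς * g t := by
  have hx' : ‖x‖ < 1 := by simpa using hx
  obtain ⟨ρ, hxρ, hρ⟩ := exists_between hx'
  have hρ0 : 0 < ρ := (norm_nonneg x).trans_lt hxρ
  obtain ⟨U, hU, hwU⟩ := exists_contDiff_eqOn_ball_of_lap_eq_zero hn hw hharm hρ0 hρ
  have h1 := hwU.euler Metric.isOpen_ball
  have h2 := h1.euler Metric.isOpen_ball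
  have h3 := h2.euler Metric.isOpen_ball
  refine ⟨fun t => U (t • x), hU.comp (contDiff_id.smul contDiff_const), ?_, fun j => ?_,
    fun t ht => ?_⟩
  · simpa using (hwU (by simpa using hxρ)).symm
  · have hev : w =ᶠ[𝓝 0] U := hwU.eventuallyEq_of_mem (Metric.ball_mem_nhds 0 hρ0)
    rw [iteratedDeriv_comp_smul_zero hU, (hev.iteratedFDeriv ℝ j).eq_of_nhds]
  · have htx : t • x ∈ Metric.ball 0 ρ := by
      rw [mem_ball_zero_iff, norm_smul]
      exact (mul_le_of_le_one_left (norm_nonneg x) ht).trans_lt hxρ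
    rw [realEuler_comp_smul hU, realEuler_comp_smul hU.euler, realEuler_comp_smul hU.euler.euler]
    beta_reduce
    rw [← hwU htx, ← h1 htx, ← h2 htx, ← h3 htx]
    exact heq _ (Metric.ball_subset_ball hρ.le htx)

end EulerOperator

section HomogeneousPolynomial

open Filter
open scoped Topology

variable {n : ℕ}

theorem lap_const_mul (c : ℝ) (f : EuclideanSpace ℝ (Fin n) → ℝ) (x : EuclideanSpace ℝ (Fin n)) :
    lap (fun y => c * f y) x = c * lap f x := by
  have h : ∀ (f : EuclideanSpace ℝ (Fin n) → ℝ) y,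
      fderiv ℝ (fun y => c * f y) y = c • fderiv ℝ f y := fun f y =>
    congrFun (fderiv_const_smul_field (f := f) c) y
  simp [lap, h, Finset.mul_sum]

theorem lap_comp_smul (c : ℝ) (f : EuclideanSpace ℝ (Fin n) → ℝ) (x : EuclideanSpace ℝ (Fin n)) :
    lap (fun y => f (c • y)) x = c ^ 2 * lap f (c • x) := by
  have h : ∀ i : Fin n, fderiv ℝ (fun y => c * fderiv ℝ f (c • y) (EuclideanSpace.single i 1)) x =
      c • c • fderiv ℝ (fun y => fderiv ℝ f y (EuclideanSpace.single i 1)) (c • x) := by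
    intro i
    rw [← fderiv_comp_smul]
    exact congrFun (fderiv_const_smul_field
      (f := fun y => fderiv ℝ f (c • y) (EuclideanSpace.single i 1)) c) x
  simp [lap, fderiv_comp_smul, h, Finset.mul_sum, pow_two, mul_assoc]

theorem lap_eq_zero_of_homogeneous {f : EuclideanSpace ℝ (Fin n) → ℝ} {k : ℕ}
    (hf : ∀ (c : ℝ) y, f (c • y) = c ^ k * f y) (hlap : ∀ x ∈ Metric.ball 0 1, lap f x = 0)
    (x : EuclideanSpace ℝ (Fin n)) : lap f x = 0 := by
  set c : ℝ := (‖x‖ + 1)⁻¹ with hc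
  have hc0 : 0 < c := by positivity
  have hcx : c • x ∈ Metric.ball 0 1 := by
    rw [mem_ball_zero_iff, norm_smul, Real.norm_of_nonneg hc0.le, hc,
      inv_mul_lt_one₀ (by positivity)]
    linarith
  have h1 := lap_comp_smul c f x
  simp_rw [hf] at h1
  rw [lap_const_mul, hlap _ hcx, mul_zero] at h1
  exact (mul_eq_zero.1 h1).resolve_left (by positivity)

/-- The homogeneous polynomial `x ↦ T(x, …, x)`. -/
noncomputable def ContinuousMultilinearMap.diagonalPolynomial {k : ℕ}
    (T : ContinuousMultilinearMap ℝ (fun _ : Fin k => EuclideanSpace ℝ (Fin n)) ℝ) :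
    MvPolynomial (Fin n) ℝ :=
  ∑ r : Fin k → Fin n, MvPolynomial.C (T fun i => EuclideanSpace.single (r i) 1) *
    ∏ i, MvPolynomial.X (r i)

theorem ContinuousMultilinearMap.isHomogeneous_diagonalPolynomial {k : ℕ}
    (T : ContinuousMultilinearMap ℝ (fun _ : Fin k => EuclideanSpace ℝ (Fin n)) ℝ) :
    T.diagonalPolynomial.IsHomogeneous k := by
  refine MvPolynomial.IsHomogeneous.sum _ _ _ fun r _ => MvPolynomial.IsHomogeneous.C_mul ?_ _
  simpa using MvPolynomial.IsHomogeneous.prod (R := ℝ) Finset.univ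
    (fun i => MvPolynomial.X (r i)) (fun _ => 1) fun i _ => MvPolynomial.isHomogeneous_X _ _

theorem ContinuousMultilinearMap.eval_diagonalPolynomial {k : ℕ}
    (T : ContinuousMultilinearMap ℝ (fun _ : Fin k => EuclideanSpace ℝ (Fin n)) ℝ)
    (x : EuclideanSpace ℝ (Fin n)) :
    MvPolynomial.eval x T.diagonalPolynomial = T fun _ => x := by
  conv_rhs => rw [← EuclideanSpace.sum_smul_single_one x]
  rw [T.map_sum]
  simp only [diagonalPolynomial, _root_.map_sum, map_mul, map_prod, MvPolynomial.eval_C,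
    MvPolynomial.eval_X]
  refine Finset.sum_congr rfl fun r _ => ?_
  rw [T.map_smul_univ, smul_eq_mul, mul_comm]

end HomogeneousPolynomial

/-- If `n ≥ 2`, `β ≥ 0`, and `w` is a nonzero harmonic function on the open
unit ball `𝔹 ⊂ ℝⁿ` with `n·ℰ²w + 2·ℰ³w + β((n-2)ℰw + ℰ²w) = ς·w` on `𝔹`, then there is a
unique nonnegative integer `k` with `ς = 2k³ + nk² + β(k² + (n-2)k) = k²(n+2k) + βk(k+n-2)`,
and `w` is the restriction to `𝔹` of a harmonic homogeneous polynomial of degree `k`. -/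
theorem harmonic_solution_is_spherical_harmonic (n : ℕ) (hn : 2 ≤ n) (β ς : ℝ) (hβ : 0 ≤ β)
    (w : EuclideanSpace ℝ (Fin n) → ℝ)
    (hw : ContDiffOn ℝ 2 w (Metric.ball (0 : EuclideanSpace ℝ (Fin n)) 1))
    (hharm : ∀ x ∈ Metric.ball (0 : EuclideanSpace ℝ (Fin n)) 1, lap w x = 0)
    (hne : ∃ x ∈ Metric.ball (0 : EuclideanSpace ℝ (Fin n)) 1, w x ≠ 0)
    (heq : ∀ x ∈ Metric.ball (0 : EuclideanSpace ℝ (Fin n)) 1,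
      (n : ℝ) * euler (euler w) x + 2 * euler (euler (euler w)) x +
        β * (((n : ℝ) - 2) * euler w x + euler (euler w) x) = ς * w x) :
    ∃! k : ℕ,
      (ς = 2 * (k : ℝ) ^ 3 + (n : ℝ) * (k : ℝ) ^ 2 +
          β * ((k : ℝ) ^ 2 + ((n : ℝ) - 2) * (k : ℝ)) ∧
        ς = (k : ℝ) ^ 2 * ((n : ℝ) + 2 * (k : ℝ)) +
          β * (k : ℝ) * ((k : ℝ) + (n : ℝ) - 2)) ∧
      ∃ P : MvPolynomial (Fin n) ℝ, P.IsHomogeneous k ∧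
        (∀ x : EuclideanSpace ℝ (Fin n), lap (fun y => MvPolynomial.eval y P) x = 0) ∧
        ∀ x ∈ Metric.ball (0 : EuclideanSpace ℝ (Fin n)) 1, w x = MvPolynomial.eval x P := by
  have hn0 : 0 < n := by omega
  have hmono := eulerSymbol_strictMono hn hβ
  have hex : ∃ k : ℕ, eulerSymbol n β k = ς := by
    by_contra! h
    obtain ⟨x, hx, hwx⟩ := hne
    obtain ⟨g, hg, hg1, -, hode⟩ := exists_ray_restriction hn0 hw hharm heq hx
    exact hwx (hg1 ▸ eq_zero_of_resonant_iteratedDeriv_eq_zero hg hode fun j hj => (h j hj).elim)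
  obtain ⟨k, hk⟩ := hex
  have huniq : ∀ j : ℕ, eulerSymbol n β j = ς → j = k := fun j hj =>
    hmono.injective (hj.trans hk.symm)
  refine ⟨k, ⟨⟨hk.symm, ?_⟩, ?_⟩, fun j hj => huniq j hj.1.1.symm⟩
  · rw [← hk, eulerSymbol]
    ring
  · let T := (k.factorial : ℝ)⁻¹ • iteratedFDeriv ℝ k w 0
    have hwP : ∀ x ∈ Metric.ball (0 : EuclideanSpace ℝ (Fin n)) 1,
        w x = MvPolynomial.eval x T.diagonalPolynomial := by
      intro x hx
      obtain ⟨g, hg, hg1, hgj, hode⟩ := exists_ray_restriction hn0 hw hharm heq hx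
      rw [T.eval_diagonalPolynomial, ← hg1,
        eq_iteratedDeriv_div_factorial_of_resonant hg hode hk huniq, hgj]
      rfl
    refine ⟨T.diagonalPolynomial, T.isHomogeneous_diagonalPolynomial,
      lap_eq_zero_of_homogeneous (k := k) (fun c y => ?_) fun x hx => ?_, hwP⟩
    · rw [T.eval_diagonalPolynomial, T.eval_diagonalPolynomial, T.map_smul_univ]
      simp
    · rw [← hharm x hx]
      refine (lap_congr_of_eventuallyEq ?_).symm
      filter_upwards [Metric.isOpen_ball.mem_nhds hx] with y hy
      exact hwP y hy
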